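/- Let n ≥ 1, α ∈ (1,2), Λ > 0, k₁ > 0. Let b : ℝⁿ → ℝⁿ satisfy ⟨x, b(x)⟩ ≤ −k₁|x| for all x, and let σ : ℝⁿ → (n × n real matrices) satisfy |σ(x) ξ| ≤ Λ|ξ| for all x, ξ. Define r(x) = √(1+|x|²) and C₁ = (Λ²/2)∫_{0<|y|<1} |y|^{2−n−α} dy + Λ ∫_{|y|≥1} |y|^{1−n−α} dy. Then for every x ∈ ℝⁿ, ⟨b(x), x⟩/√(1+|x|²) + ∫_{ℝⁿ\{0}} [ r(x + σ(x) y) − r(x) − 𝟙_{|y|<1}·⟨σ(x) y, x⟩/√(1+|x|²) ] |y|^{−n−α} dy ≤ −(k₁/√2)·𝟙_{|x|≥1} + C₁, where the integral converges absolutely. -/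

import Mathlib

open MeasureTheory
open scoped RealInnerProductSpace

lemma aux_small {E : Type*} [NormedAddCommGroup E] [InnerProductSpace ℝ E] (x v : E) :
    0 ≤ Real.sqrt (1 + ‖x + v‖ ^ 2) - Real.sqrt (1 + ‖x‖ ^ 2) -
        ⟪v, x⟫ / Real.sqrt (1 + ‖x‖ ^ 2) ∧
      Real.sqrt (1 + ‖x + v‖ ^ 2) - Real.sqrt (1 + ‖x‖ ^ 2) -
        ⟪v, x⟫ / Real.sqrt (1 + ‖x‖ ^ 2) ≤ ‖v‖ ^ 2 / 2 := by
  have hs2 : Real.sqrt (1 + ‖x‖ ^ 2) ^ 2 = 1 + ‖x‖ ^ 2 := Real.sq_sqrt (by positivity)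
  have ht2 : Real.sqrt (1 + ‖x + v‖ ^ 2) ^ 2 = 1 + ‖x + v‖ ^ 2 := Real.sq_sqrt (by positivity)
  have hs1 : 1 ≤ Real.sqrt (1 + ‖x‖ ^ 2) := Real.one_le_sqrt.2 (by nlinarith [sq_nonneg ‖x‖])
  have ht0 : 0 ≤ Real.sqrt (1 + ‖x + v‖ ^ 2) := Real.sqrt_nonneg _
  have hexp := norm_add_sq_real x v
  rw [real_inner_comm] at hexp
  have hcs := abs_real_inner_le_norm v x
  generalize Real.sqrt (1 + ‖x‖ ^ 2) = s at *
  generalize Real.sqrt (1 + ‖x + v‖ ^ 2) = t at *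
  generalize ⟪v, x⟫ = p at *
  have hs0 : 0 < s := by linarith
  have hp2 : p ^ 2 ≤ ‖v‖ ^ 2 * ‖x‖ ^ 2 := by
    rw [← mul_pow]; exact sq_le_sq' (by linarith [neg_abs_le p]) (by linarith [le_abs_self p])
  have key : t - s - p / s = (t * s - s ^ 2 - p) / s := by field_simp
  rw [key]
  constructor
  · apply div_nonneg _ hs0.le
    have : s ^ 2 + p ≤ t * s := by
      refine le_of_abs_le (abs_le_of_sq_le_sq ?_ (by positivity))
      rw [mul_pow, ht2, hexp]
      nlinarith [sq_nonneg ‖v‖]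
    linarith
  · rw [div_le_iff₀ hs0]
    nlinarith [sq_nonneg (t - s), sq_nonneg ‖v‖]

lemma aux_large1 {E : Type*} [NormedAddCommGroup E] [InnerProductSpace ℝ E] (x v : E) :
    Real.sqrt (1 + ‖x + v‖ ^ 2) ≤ Real.sqrt (1 + ‖x‖ ^ 2) + ‖v‖ := by
  have hs2 : Real.sqrt (1 + ‖x‖ ^ 2) ^ 2 = 1 + ‖x‖ ^ 2 := Real.sq_sqrt (by positivity)
  have hsx : ‖x‖ ≤ Real.sqrt (1 + ‖x‖ ^ 2) := Real.le_sqrt_of_sq_le (by linarith)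
  apply Real.sqrt_le_iff.2 ⟨by positivity, ?_⟩
  have h := norm_add_le x v
  have := mul_le_mul_of_nonneg_right hsx (norm_nonneg v)
  nlinarith [norm_nonneg (x + v), pow_le_pow_left₀ (norm_nonneg _) h 2]

lemma aux_large {E : Type*} [NormedAddCommGroup E] [InnerProductSpace ℝ E] (x v : E) :
    |Real.sqrt (1 + ‖x + v‖ ^ 2) - Real.sqrt (1 + ‖x‖ ^ 2)| ≤ ‖v‖ := by
  have h1 := aux_large1 x v
  have h2 := aux_large1 (x + v) (-v)
  rw [add_neg_cancel_right, norm_neg] at h2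
  exact abs_le.2 ⟨by linarith, by linarith⟩

lemma aux_int_small (n : ℕ) (hn : 1 ≤ n) (s : ℝ) (hs : -(n : ℝ) < s) :
    IntegrableOn (fun y : EuclideanSpace ℝ (Fin n) => ‖y‖ ^ s)
      (Metric.ball (0 : EuclideanSpace ℝ (Fin n)) 1) := by
  haveI : Nonempty (Fin n) := ⟨⟨0, hn⟩⟩
  rw [integrableOn_fun_norm_addHaar volume (f := fun r : ℝ => r ^ s)]
  have h := (intervalIntegral.integrableOn_Ioo_rpow_iff (s := (n : ℝ) - 1 + s) one_pos).2
    (by linarith)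
  refine h.congr_fun (fun y hy => ?_) measurableSet_Ioo
  simp only [finrank_euclideanSpace, Fintype.card_fin, smul_eq_mul]
  rw [Real.rpow_add hy.1, ← Real.rpow_natCast, Nat.cast_sub hn, Nat.cast_one]

lemma aux_int_large (n : ℕ) (hn : 1 ≤ n) (s : ℝ) (hs : s < -(n : ℝ)) :
    IntegrableOn (fun y : EuclideanSpace ℝ (Fin n) => ‖y‖ ^ s)
      {y : EuclideanSpace ℝ (Fin n) | 1 ≤ ‖y‖} := by
  haveI : Nonempty (Fin n) := ⟨⟨0, hn⟩⟩
  have hm : MeasurableSet {y : EuclideanSpace ℝ (Fin n) | 1 ≤ ‖y‖} :=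
    measurableSet_le measurable_const measurable_norm
  rw [← integrable_indicator_iff hm]
  have h := integrableOn_Ioi_rpow_of_lt (a := (n : ℝ) - 1 + s) (by linarith) one_pos
  rw [← integrableOn_Ici_iff_integrableOn_Ioi, ← integrable_indicator_iff measurableSet_Ici] at h
  have h2 := (integrable_fun_norm_addHaar (volume : Measure (EuclideanSpace ℝ (Fin n)))
    (f := (Set.Ici (1 : ℝ)).indicator fun r : ℝ => r ^ s)).2 (by
      refine h.integrableOn.congr_fun (fun y hy => ?_) measurableSet_Ioi
      simp only [finrank_euclideanSpace, Fintype.card_fin, smul_eq_mul, Set.indicator]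
      split_ifs
      · rw [Real.rpow_add hy, ← Real.rpow_natCast, Nat.cast_sub hn, Nat.cast_one]
      · simp)
  exact h2

/-- Lyapunov estimate for the generator of the α-stable SDE: under the
dissipativity condition `⟨x,b(x)⟩ ≤ −k₁|x|` and the bound `|σ(x)ξ| ≤ Λ|ξ|`,
for `r(x) = √(1+|x|²)` one has
`A r(x) = b(x)·∇r(x) + ∫ [r(x+σ(x)y) − r(x) − 𝟙_{|y|<1}⟨σ(x)y, ∇r(x)⟩] ν(dy)
  ≤ −(k₁/√2)𝟙_{|x|≥1} + C₁`,
with `C₁ = (Λ²/2)∫_{0<|y|<1}|y|^{2−n−α} dy + Λ∫_{|y|≥1}|y|^{1−n−α} dy`, the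
integral converging absolutely. -/
theorem stmt_15 (n : ℕ) (hn : 1 ≤ n) (α Λ k₁ : ℝ) (hα : α ∈ Set.Ioo (1 : ℝ) 2)
    (hΛ : 0 < Λ) (hk₁ : 0 < k₁)
    (b : EuclideanSpace ℝ (Fin n) → EuclideanSpace ℝ (Fin n))
    (hb : ∀ x, ⟪x, b x⟫ ≤ -k₁ * ‖x‖)
    (σ : EuclideanSpace ℝ (Fin n) →
      EuclideanSpace ℝ (Fin n) →ₗ[ℝ] EuclideanSpace ℝ (Fin n))
    (hσ : ∀ x ξ, ‖σ x ξ‖ ≤ Λ * ‖ξ‖) :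
    ∀ x : EuclideanSpace ℝ (Fin n),
      IntegrableOn
        (fun y =>
          (Real.sqrt (1 + ‖x + σ x y‖ ^ 2) - Real.sqrt (1 + ‖x‖ ^ 2) -
              (if ‖y‖ < 1 then ⟪σ x y, x⟫ / Real.sqrt (1 + ‖x‖ ^ 2) else 0)) *
            ‖y‖ ^ (-(n : ℝ) - α))
        ({0}ᶜ : Set (EuclideanSpace ℝ (Fin n))) ∧
      ⟪b x, x⟫ / Real.sqrt (1 + ‖x‖ ^ 2) +
          (∫ y in ({0}ᶜ : Set (EuclideanSpace ℝ (Fin n))),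
            (Real.sqrt (1 + ‖x + σ x y‖ ^ 2) - Real.sqrt (1 + ‖x‖ ^ 2) -
                (if ‖y‖ < 1 then ⟪σ x y, x⟫ / Real.sqrt (1 + ‖x‖ ^ 2) else 0)) *
              ‖y‖ ^ (-(n : ℝ) - α)) ≤
        -(k₁ / Real.sqrt 2) * (if 1 ≤ ‖x‖ then (1 : ℝ) else 0) +
          (Λ ^ 2 / 2 *
              (∫ y in (Metric.ball (0 : EuclideanSpace ℝ (Fin n)) 1 \ {0}),
                ‖y‖ ^ (2 - (n : ℝ) - α)) +
            Λ * ∫ y in {y : EuclideanSpace ℝ (Fin n) | 1 ≤ ‖y‖},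
                ‖y‖ ^ (1 - (n : ℝ) - α)) := by
  intro x
  obtain ⟨hα1, hα2⟩ := hα
  have hn1 : (1 : ℝ) ≤ n := by exact_mod_cast hn
  set F : EuclideanSpace ℝ (Fin n) → ℝ := fun y =>
          (Real.sqrt (1 + ‖x + σ x y‖ ^ 2) - Real.sqrt (1 + ‖x‖ ^ 2) -
              (if ‖y‖ < 1 then ⟪σ x y, x⟫ / Real.sqrt (1 + ‖x‖ ^ 2) else 0)) *
            ‖y‖ ^ (-(n : ℝ) - α) with hF
  set A : Set (EuclideanSpace ℝ (Fin n)) := Metric.ball 0 1 \ {0} with hA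
  set B : Set (EuclideanSpace ℝ (Fin n)) := {y | 1 ≤ ‖y‖} with hB
  have hAm : MeasurableSet A := measurableSet_ball.diff (measurableSet_singleton _)
  have hBm : MeasurableSet B := measurableSet_le measurable_const measurable_norm
  have hAB : ({0}ᶜ : Set (EuclideanSpace ℝ (Fin n))) = A ∪ B := by
    ext y
    simp only [hA, hB, Set.mem_compl_iff, Set.mem_singleton_iff, Set.mem_union, Set.mem_diff,
      Metric.mem_ball, dist_zero_right, Set.mem_setOf_eq]
    constructor
    · intro h
      rcases lt_or_ge ‖y‖ 1 with h1 | h1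
      · exact Or.inl ⟨h1, h⟩
      · exact Or.inr h1
    · rintro (h | h)
      · exact h.2
      · rintro rfl
        norm_num at h
  have hdisj : Disjoint A B := by
    rw [Set.disjoint_left]
    rintro y ⟨h1, -⟩ h2
    rw [Metric.mem_ball, dist_zero_right] at h1
    exact absurd h1 (not_lt.2 h2)
  have hσc : Continuous (σ x) := (σ x).continuous_of_finiteDimensional
  have hFm : Measurable F := by
    have hσm : Measurable (σ x) := hσc.measurable
    refine Measurable.mul (Measurable.sub ?_ ?_) (measurable_norm.pow_const _)
    · exact (by fun_prop : Continuous fun y =>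
        Real.sqrt (1 + ‖x + σ x y‖ ^ 2) - Real.sqrt (1 + ‖x‖ ^ 2)).measurable
    · exact Measurable.ite (measurableSet_lt measurable_norm measurable_const)
        ((hσm.inner_const).div_const _) measurable_const
  have hbA : ∀ y ∈ A, 0 ≤ F y ∧ F y ≤ Λ ^ 2 / 2 * ‖y‖ ^ (2 - (n : ℝ) - α) := by
    rintro y ⟨h1, h2⟩
    rw [Metric.mem_ball, dist_zero_right] at h1
    have hy : 0 < ‖y‖ := norm_pos_iff.2 h2
    obtain ⟨l, u⟩ := aux_small x (σ x y)
    have hpow : ‖y‖ ^ (2 - (n : ℝ) - α) = ‖y‖ ^ 2 * ‖y‖ ^ (-(n : ℝ) - α) := by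
      rw [← Real.rpow_natCast, ← Real.rpow_add hy]; congr 1; push_cast; ring
    have hv : ‖σ x y‖ ^ 2 ≤ Λ ^ 2 * ‖y‖ ^ 2 := by
      rw [← mul_pow]; exact pow_le_pow_left₀ (norm_nonneg _) (hσ x y) 2
    have hq : 0 ≤ ‖y‖ ^ (-(n : ℝ) - α) := by positivity
    simp only [hF, h1, if_true]
    refine ⟨mul_nonneg l hq, ?_⟩
    rw [hpow, ← mul_assoc]
    exact mul_le_mul_of_nonneg_right (by linarith) hq
  have hbB : ∀ y ∈ B, |F y| ≤ Λ * ‖y‖ ^ (1 - (n : ℝ) - α) := by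
    intro y h1
    change 1 ≤ ‖y‖ at h1
    have hy : 0 < ‖y‖ := by linarith
    have u := aux_large x (σ x y)
    have hpow : ‖y‖ ^ (1 - (n : ℝ) - α) = ‖y‖ * ‖y‖ ^ (-(n : ℝ) - α) := by
      rw [← Real.rpow_one_add' hy.le (by linarith)]; congr 1; ring
    have hq : 0 ≤ ‖y‖ ^ (-(n : ℝ) - α) := by positivity
    simp only [hF, not_lt.2 h1, if_false, sub_zero]
    rw [hpow, ← mul_assoc, abs_mul, abs_of_nonneg hq]
    exact mul_le_mul_of_nonneg_right (u.trans (hσ x y)) hq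
  have hgA : IntegrableOn (fun y : EuclideanSpace ℝ (Fin n) =>
      Λ ^ 2 / 2 * ‖y‖ ^ (2 - (n : ℝ) - α)) A :=
    ((aux_int_small n hn _ (by linarith)).mono_set Set.diff_subset).const_mul _
  have hgB : IntegrableOn (fun y : EuclideanSpace ℝ (Fin n) =>
      Λ * ‖y‖ ^ (1 - (n : ℝ) - α)) B :=
    (aux_int_large n hn _ (by linarith)).const_mul _
  have hFA : IntegrableOn F A := by
    refine Integrable.mono' hgA hFm.aestronglyMeasurable ?_
    filter_upwards [ae_restrict_mem hAm] with y hy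
    rw [Real.norm_eq_abs, abs_of_nonneg (hbA y hy).1]
    exact (hbA y hy).2
  have hFB : IntegrableOn F B := by
    refine Integrable.mono' hgB hFm.aestronglyMeasurable ?_
    filter_upwards [ae_restrict_mem hBm] with y hy
    exact hbB y hy
  refine ⟨hAB ▸ hFA.union hFB, ?_⟩
  rw [hAB, setIntegral_union hdisj hBm hFA hFB, ← integral_const_mul, ← integral_const_mul]
  have i1 := setIntegral_mono_on hFA hgA hAm (fun y hy => (hbA y hy).2)
  have i2 := setIntegral_mono_on hFB hgB hBm (fun y hy => (le_abs_self _).trans (hbB y hy))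
  have hdrift : ⟪b x, x⟫ / Real.sqrt (1 + ‖x‖ ^ 2) ≤
      -(k₁ / Real.sqrt 2) * (if 1 ≤ ‖x‖ then (1 : ℝ) else 0) := by
    have hb' := hb x
    rw [real_inner_comm] at hb'
    have hs0 : 0 < Real.sqrt (1 + ‖x‖ ^ 2) := by positivity
    have h2 : 0 < Real.sqrt 2 := by positivity
    split_ifs with h
    · rw [div_le_iff₀ hs0]
      have : Real.sqrt (1 + ‖x‖ ^ 2) ≤ Real.sqrt 2 * ‖x‖ := by
        apply Real.sqrt_le_iff.2 ⟨by positivity, ?_⟩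
        rw [mul_pow, Real.sq_sqrt (by norm_num)]
        nlinarith
      have h3 := mul_le_mul_of_nonneg_left this (div_pos hk₁ h2).le
      have h4 : k₁ / Real.sqrt 2 * (Real.sqrt 2 * ‖x‖) = k₁ * ‖x‖ := by field_simp
      linarith
    · rw [mul_zero]
      exact div_nonpos_of_nonpos_of_nonneg
        (by nlinarith [mul_nonneg hk₁.le (norm_nonneg x)]) hs0.le
  linarith
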